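/- For every 𝒳 ⊆ C_∞, ρ(𝒳) ≤ ν^∞(𝒳). -/

import Mathlib

open MeasureTheory Filter Set Topology
open scoped ENNReal

noncomputable section

/-- The Cantor space `2^ℕ`. -/
abbrev Cantor : Type := ℕ → Bool

/-- The uniform product ("fair coin-flipping") probability measure on `2^ℕ`, realized as the
pushforward of Lebesgue measure on `[0,1)` under the binary-digit map. -/
noncomputable def cantorMeasure : Measure Cantor :=
  Measure.map (fun x : ℝ => fun n : ℕ => decide (⌊x * 2 ^ (n + 1)⌋ % 2 = 1))
    (volume.restrict (Set.Ico (0 : ℝ) 1))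

/-- The basic cylinder `[a]` determined by a finite binary sequence `a`. -/
def cyl (a : List Bool) : Set Cantor := {x | ∀ i : Fin a.length, x i = a.get i}

/-- `[A] = ⋃ a ∈ A, [a]`. -/
def cylSet (A : Set (List Bool)) : Set Cantor := ⋃ a ∈ A, cyl a

/-- The weight `2^(-|a|·r)` of a node `a`. -/
noncomputable def wt (r : ℝ) (a : List Bool) : ℝ≥0∞ := (2 : ℝ≥0∞) ^ (-(a.length : ℝ) * r)

/-- `Σ_{a ∈ A} 2^(-|a|·r)`. -/
noncomputable def wtSum (r : ℝ) (A : Set (List Bool)) : ℝ≥0∞ := ∑' a : A, wt r (a : List Bool)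

/-- `A ∈ C^∞_ε`, i.e. `Σ_{a ∈ A} 2^(-|a|·r) ≤ ε`. -/
def memCinf (r ε : ℝ) (A : Set (List Bool)) : Prop := wtSum r A ≤ ENNReal.ofReal ε

/-- The `r`-dimensional dyadic Hausdorff capacity `λ^r_∞`. -/
noncomputable def hcap (r : ℝ) (X : Set Cantor) : ℝ≥0∞ :=
  ⨅ (A : Set (List Bool)) (_ : X ⊆ cylSet A), wtSum r A

/-- `□_δ(X) = inf {λ^r_∞(X \ Z) : Z measurable, λ Z < δ}`. -/
noncomputable def sqcap (r δ : ℝ) (X : Set Cantor) : ℝ≥0∞ :=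
  ⨅ (Z : Set Cantor) (_ : MeasurableSet Z) (_ : cantorMeasure Z < ENNReal.ofReal δ),
    hcap r (X \ Z)

/-- The relation `□_{Θ,Γ}(X)` for `X ⊆ (2^ℕ)^(d+1)` (the index `d` codes dimension `d+1`):
for dimension `1` it says `□_{Θ 0}(X) ≥ Γ 0`, and for dimension `n+2` it says
`□_{Θ (n+1)}({x : □_{Θ,Γ}(X(x,·))}) ≥ Γ (n+1)`, slicing along the first coordinate. -/
def SqTG (r : ℝ) (Θ Γ : ℕ → ℝ) : (d : ℕ) → Set (Fin (d + 1) → Cantor) → Prop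
  | 0, X => ENNReal.ofReal (Γ 0) ≤ sqcap r (Θ 0) {y : Cantor | (fun _ : Fin 1 => y) ∈ X}
  | (n + 1), X => ENNReal.ofReal (Γ (n + 1)) ≤
      sqcap r (Θ (n + 1))
        {x : Cantor | SqTG r Θ Γ n {y : Fin (n + 1) → Cantor | Fin.cons x y ∈ X}}

/-- `□_{Θ,Γ}` reindexed by the true dimension `d ≥ 1`. -/
def SqDim (r : ℝ) (Θ Γ : ℕ → ℝ) : (d : ℕ) → Set (Fin d → Cantor) → Prop
  | 0, _ => False
  | (n + 1), X => SqTG r Θ Γ n X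

/-- `□_*(X)` : `□_{η,Γ}(X)` holds for some `η : ℕ → ℝ⁺`. -/
def SqStarDim (r : ℝ) (Γ : ℕ → ℝ) (d : ℕ) (X : Set (Fin d → Cantor)) : Prop :=
  ∃ η : ℕ → ℝ, (∀ i, 0 < η i) ∧ SqDim r η Γ d X

/-- `⟨z,F⟩ = {w ∈ 𝒳 : z ∉ [F w]}`. -/
def angbr (z : Cantor) (F : Set (List Bool) → Set (List Bool))
    (𝒳 : Set (Set (List Bool))) : Set (Set (List Bool)) := {w ∈ 𝒳 | z ∉ cylSet (F w)}

/-- `ρ*(𝒳)`: the set of `d > 1` such that for every compact `C ⊆ (2^ℕ)^d` with `□(C)` and every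
continuous `F : C → 2^ℕ` there is `x ∈ 𝒳` with `□_*(F⁻¹[x])`. -/
def rhoStar (r : ℝ) (Θ Γ : ℕ → ℝ) (𝒳 : Set (Set (List Bool))) : Set ℕ :=
  {d : ℕ | 1 < d ∧ ∀ C : Set (Fin d → Cantor), IsCompact C → SqDim r Θ Γ d C →
    ∀ F : (Fin d → Cantor) → Cantor, ContinuousOn F C →
      ∃ x ∈ 𝒳, SqStarDim r Γ d (C ∩ F ⁻¹' cylSet x)}

/-- `ρ(𝒳) = sup ρ*(𝒳)` (with `sup ∅ = 0`). -/
noncomputable def rho (r : ℝ) (Θ Γ : ℕ → ℝ) (𝒳 : Set (Set (List Bool))) : ℕ∞ :=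
  sSup ((fun d : ℕ => (d : ℕ∞)) '' rhoStar r Θ Γ 𝒳)

/-- The sets `𝒩_j` (with finite-set-valued test functions `F`). -/
def Nrec (r : ℝ) (Θ Γ : ℕ → ℝ) : ℕ → Set (Set (Set (List Bool)))
  | 0 => {𝒳 | 𝒳.Nonempty}
  | 1 => {𝒳 | cylSet (⋃₀ 𝒳) = Set.univ}
  | (k + 2) => {𝒳 | ∀ F : Set (List Bool) → Set (List Bool),
      (∀ a ∈ 𝒳, (F a).Finite ∧ memCinf r (Γ (k + 1) / 2) (F a)) →
      sqcap r (Θ k) {z : Cantor | angbr z F 𝒳 ∉ Nrec r Θ Γ (k + 1)} <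
        ENNReal.ofReal (Γ (k + 1))}

/-- The sets `𝒩^∞_j` (with `C^∞`-valued test functions `F`). -/
def NrecInf (r : ℝ) (Θ Γ : ℕ → ℝ) : ℕ → Set (Set (Set (List Bool)))
  | 0 => {𝒳 | 𝒳.Nonempty}
  | 1 => {𝒳 | cylSet (⋃₀ 𝒳) = Set.univ}
  | (k + 2) => {𝒳 | ∀ F : Set (List Bool) → Set (List Bool),
      (∀ a ∈ 𝒳, memCinf r (Γ (k + 1) / 2) (F a)) →
      sqcap r (Θ k) {z : Cantor | angbr z F 𝒳 ∉ NrecInf r Θ Γ (k + 1)} <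
        ENNReal.ofReal (Γ (k + 1))}

/-- `ν(𝒳) = sup {j : 𝒳 ∈ 𝒩_j}`. -/
noncomputable def nu (r : ℝ) (Θ Γ : ℕ → ℝ) (𝒳 : Set (Set (List Bool))) : ℕ∞ :=
  sSup ((fun j : ℕ => (j : ℕ∞)) '' {j | 𝒳 ∈ Nrec r Θ Γ j})

/-- `ν^∞(𝒳) = sup {j : 𝒳 ∈ 𝒩^∞_j}`. -/
noncomputable def nuInf (r : ℝ) (Θ Γ : ℕ → ℝ) (𝒳 : Set (Set (List Bool))) : ℕ∞ :=
  sSup ((fun j : ℕ => (j : ℕ∞)) '' {j | 𝒳 ∈ NrecInf r Θ Γ j})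

/-- The binary digits of a real number after the binary point. -/
def binaryDigits (x : ℝ) : Cantor := fun n => decide (⌊x * 2 ^ (n + 1)⌋ % 2 = 1)

theorem measurable_binaryDigits : Measurable binaryDigits := by
  refine measurable_pi_lambda _ fun n => ?_
  have h : Measurable fun x : ℝ => ⌊x * 2 ^ (n + 1)⌋ :=
    Int.measurable_floor.comp (measurable_id.mul_const _)
  exact (measurable_from_top (f := fun k : ℤ => decide (k % 2 = 1))).comp h

theorem cantorMeasure_eq :
    cantorMeasure = Measure.map binaryDigits (volume.restrict (Set.Ico (0 : ℝ) 1)) := rfl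

instance : IsProbabilityMeasure cantorMeasure := by
  have : IsProbabilityMeasure (volume.restrict (Set.Ico (0 : ℝ) 1)) := ⟨by simp⟩
  rw [cantorMeasure_eq]
  exact Measure.isProbabilityMeasure_map measurable_binaryDigits.aemeasurable

theorem isClopen_cyl (a : List Bool) : IsClopen (cyl a) := by
  have h : cyl a = ⋂ i : Fin a.length, (fun x : Cantor => x i) ⁻¹' {a.get i} := by
    ext x
    simp [cyl]
  rw [h]
  exact isClopen_iInter_of_finite fun i =>
    (isClopen_discrete _).preimage (continuous_apply (i : ℕ))

theorem isOpen_cyl (a : List Bool) : IsOpen (cyl a) := (isClopen_cyl a).isOpen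

theorem isOpen_cylSet (A : Set (List Bool)) : IsOpen (cylSet A) :=
  isOpen_biUnion fun a _ => isOpen_cyl a

theorem floor_mul_two_pow_eq {x y : ℝ} (hx : x ∈ Ico (0 : ℝ) 1) (hy : y ∈ Ico (0 : ℝ) 1) (n : ℕ)
    (h : ∀ i < n, binaryDigits x i = binaryDigits y i) :
    ⌊x * 2 ^ n⌋ = ⌊y * 2 ^ n⌋ := by
  induction n with
  | zero => simp [Int.floor_eq_zero_iff.2 hx, Int.floor_eq_zero_iff.2 hy]
  | succ n ih =>
    have ih := ih fun i hi => h i (hi.trans n.lt_succ_self)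
    have key (z : ℝ) : ⌊z * 2 ^ (n + 1)⌋ / 2 = ⌊z * 2 ^ n⌋ := by
      have := Int.floor_div_natCast (z * 2 ^ (n + 1)) 2
      rw [← Nat.cast_two (R := ℤ), ← this]
      congr 1
      push_cast
      ring
    have hd := h n n.lt_succ_self
    simp only [binaryDigits, decide_eq_decide] at hd
    have hx := key x
    have hy := key y
    omega

theorem cantorMeasure_cyl_le (a : List Bool) :
    cantorMeasure (cyl a) ≤ (2 : ℝ≥0∞) ^ (-(a.length : ℝ)) := by
  rw [cantorMeasure_eq, Measure.map_apply measurable_binaryDigits (isOpen_cyl a).measurableSet,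
    Measure.restrict_apply (measurable_binaryDigits (isOpen_cyl a).measurableSet)]
  rcases Set.eq_empty_or_nonempty (binaryDigits ⁻¹' cyl a ∩ Ico 0 1) with h | ⟨x, hxa, hx⟩
  · simp [h]
  have hsub : binaryDigits ⁻¹' cyl a ∩ Ico 0 1 ⊆
      Ico ((⌊x * 2 ^ a.length⌋ : ℝ) / 2 ^ a.length)
        (((⌊x * 2 ^ a.length⌋ : ℝ) + 1) / 2 ^ a.length) := by
    rintro y ⟨hya, hy⟩
    have hfl := floor_mul_two_pow_eq hx hy a.length fun i hi =>
      (hxa ⟨i, hi⟩).trans (hya ⟨i, hi⟩).symm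
    rw [hfl]
    exact ⟨(div_le_iff₀ (by positivity)).2 (Int.floor_le _),
      (lt_div_iff₀ (by positivity)).2 (Int.lt_floor_add_one _)⟩
  refine (measure_mono hsub).trans_eq ?_
  rw [Real.volume_Ico, ← sub_div, add_sub_cancel_left, ENNReal.rpow_neg, ENNReal.rpow_natCast,
    one_div, ENNReal.ofReal_inv_of_pos (by positivity), ENNReal.ofReal_pow (by norm_num)]
  simp

theorem cantorMeasure_cylSet_le (A : Set (List Bool)) :
    cantorMeasure (cylSet A) ≤ ∑' a : A, (2 : ℝ≥0∞) ^ (-((a : List Bool).length : ℝ)) :=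
  (measure_biUnion_le _ A.to_countable _).trans
    (ENNReal.tsum_le_tsum fun a => cantorMeasure_cyl_le a)

theorem cantorMeasure_cylSet_le_wtSum {r : ℝ} (hr : r ≤ 1) (A : Set (List Bool)) :
    cantorMeasure (cylSet A) ≤ wtSum r A := by
  refine (cantorMeasure_cylSet_le A).trans (ENNReal.tsum_le_tsum fun a => ?_)
  refine ENNReal.rpow_le_rpow_of_exponent_le (by norm_num) ?_
  nlinarith [Nat.cast_nonneg (α := ℝ) (a : List Bool).length]

theorem wtSum_mono (r : ℝ) {A B : Set (List Bool)} (h : A ⊆ B) : wtSum r A ≤ wtSum r B :=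
  ENNReal.tsum_mono_subtype _ h

theorem cantorMeasure_cylSet_le_of_length_ge {r : ℝ} (hr : r ≤ 1) (m : ℕ)
    (A : Set (List Bool)) :
    cantorMeasure (cylSet {a ∈ A | m ≤ a.length}) ≤
      (2 : ℝ≥0∞) ^ (-(m : ℝ) * (1 - r)) * wtSum r A := by
  refine (cantorMeasure_cylSet_le _).trans ?_
  refine le_trans ?_ (mul_le_mul_right (wtSum_mono r (sep_subset A fun a => m ≤ a.length)) _)
  rw [wtSum, ← ENNReal.tsum_mul_left]
  refine ENNReal.tsum_le_tsum fun a => ?_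
  rw [wt, ← ENNReal.rpow_add _ _ (by norm_num) (by norm_num)]
  refine ENNReal.rpow_le_rpow_of_exponent_le (by norm_num) ?_
  have : (m : ℝ) ≤ (a : List Bool).length := Nat.cast_le.2 a.2.2
  nlinarith

/-- The part of a family of bounded weight lying in high levels has small measure, uniformly. -/
theorem exists_level_cantorMeasure_le {r : ℝ} (hr : r < 1) (c : ℝ) {ε : ℝ≥0∞} (hε : 0 < ε) :
    ∃ m : ℕ, ∀ A, memCinf r c A → cantorMeasure (cylSet {a ∈ A | m ≤ a.length}) ≤ ε := by
  have hlim : Tendsto (fun m : ℕ => ((2 : ℝ≥0∞) ^ (-(1 - r))) ^ m * ENNReal.ofReal c) atTop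
      (𝓝 (0 * ENNReal.ofReal c)) := by
    refine ENNReal.Tendsto.mul_const ?_ (Or.inr ENNReal.ofReal_ne_top)
    exact ENNReal.tendsto_pow_atTop_nhds_zero_of_lt_one
      (ENNReal.rpow_lt_one_of_one_lt_of_neg (by norm_num) (by linarith))
  rw [zero_mul] at hlim
  obtain ⟨m, hm⟩ := (hlim.eventually_lt_const hε).exists
  refine ⟨m, fun A hA => (cantorMeasure_cylSet_le_of_length_ge hr.le m A).trans ?_⟩
  refine (mul_le_mul_right hA _).trans (le_of_eq_of_le ?_ hm.le)
  rw [← ENNReal.rpow_natCast, ← ENNReal.rpow_mul]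
  congr 2
  ring

theorem hcap_mono (r : ℝ) {X Y : Set Cantor} (h : X ⊆ Y) : hcap r X ≤ hcap r Y :=
  le_iInf₂ fun A hA => iInf₂_le A (h.trans hA)

theorem sqcap_mono (r δ : ℝ) {X Y : Set Cantor} (h : X ⊆ Y) : sqcap r δ X ≤ sqcap r δ Y :=
  le_iInf₂ fun Z hZ => le_iInf fun hδ =>
    (iInf₂_le_of_le Z hZ (iInf_le _ hδ)).trans (hcap_mono r (sdiff_subset_sdiff_left h))

theorem sqcap_le_of_subset {r δ : ℝ} {X Z : Set Cantor} {A : Set (List Bool)}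
    (hZ : MeasurableSet Z) (hδ : cantorMeasure Z < ENNReal.ofReal δ) (h : X \ Z ⊆ cylSet A) :
    sqcap r δ X ≤ wtSum r A :=
  (iInf₂_le_of_le Z hZ (iInf_le _ hδ)).trans (iInf₂_le A h)

theorem sqcap_cylSet_le {r δ : ℝ} (hδ : 0 < δ) (A : Set (List Bool)) :
    sqcap r δ (cylSet A) ≤ wtSum r A :=
  sqcap_le_of_subset MeasurableSet.empty (by simpa using hδ) sdiff_subset

theorem sqcap_empty {r δ : ℝ} (hδ : 0 < δ) : sqcap r δ ∅ = 0 :=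
  le_antisymm ((sqcap_le_of_subset (A := ∅) MeasurableSet.empty (by simpa using hδ)
    (by simp)).trans (by simp [wtSum])) zero_le

/-- Removing a set of measure less than `ε` from `X` costs at most `ε` in the parameter `δ`. -/
theorem sqcap_add_le_sqcap {r δ ε : ℝ} (hδ : 0 ≤ δ) {X Y E : Set Cantor} (hE : MeasurableSet E)
    (hEε : cantorMeasure E ≤ ENNReal.ofReal ε) (h : X \ E ⊆ Y) (hε : 0 ≤ ε) :
    sqcap r (δ + ε) X ≤ sqcap r δ Y := by
  refine le_iInf₂ fun Z hZ => le_iInf fun hZδ => le_iInf₂ fun A hA => ?_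
  refine sqcap_le_of_subset (hZ.union hE) ?_ (fun x hx => hA ?_)
  · rw [ENNReal.ofReal_add hδ hε]
    exact (measure_union_le _ _).trans_lt
      (ENNReal.add_lt_add_of_lt_of_le ((measure_ne_top _ _)) hZδ hEε)
  · exact ⟨h ⟨hx.1, fun hxE => hx.2 (Or.inr hxE)⟩, fun hxZ => hx.2 (Or.inl hxZ)⟩

theorem le_sqcap_univ {r γ : ℝ} (hr : r ≤ 1) :
    ENNReal.ofReal γ ≤ sqcap r (1 - γ) univ := by
  refine le_iInf₂ fun Z hZ => le_iInf fun hZδ => le_iInf₂ fun A hA => ?_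
  refine le_trans ?_ (cantorMeasure_cylSet_le_wtSum hr A)
  have h1 : 1 ≤ cantorMeasure Z + cantorMeasure (cylSet A) := by
    rw [← measure_univ (μ := cantorMeasure)]
    refine (measure_mono fun x _ => ?_).trans (measure_union_le _ _)
    by_cases hx : x ∈ Z
    · exact Or.inl hx
    · exact Or.inr (hA ⟨trivial, hx⟩)
  have hγ : ENNReal.ofReal (1 - γ) ≠ 0 := (zero_le.trans_lt hZδ).ne'
  have hγ' : 0 < 1 - γ := by simpa using hγ
  by_contra! hlt
  have h2 := h1.trans_lt (ENNReal.add_lt_add hZδ hlt)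
  rcases le_or_gt γ 0 with h0 | h0
  · simp [ENNReal.ofReal_of_nonpos h0] at hlt
  · rw [← ENNReal.ofReal_add hγ'.le h0.le] at h2
    simp at h2

theorem mem_cyl_append_singleton {y : Cantor} {a : List Bool} {b : Bool} :
    y ∈ cyl (a ++ [b]) ↔ y ∈ cyl a ∧ y a.length = b := by
  simp only [cyl, mem_ofPred_eq, Fin.forall_iff, List.get_eq_getElem, List.length_append,
    List.length_singleton]
  constructor
  · intro h
    refine ⟨fun i hi => ?_, ?_⟩
    · rw [h i (by omega), List.getElem_append_left]
    · rw [h a.length (by omega), List.getElem_concat_length rfl]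
  · rintro ⟨h, hb⟩ i hi
    rcases (Nat.lt_succ_iff_lt_or_eq.1 hi) with h' | rfl
    · rw [h i h', List.getElem_append_left]
    · rw [hb, List.getElem_concat_length rfl]

section Selection

variable {X : Type*}

/-- The points over which the relation `R` has a value in the cylinder `[a]`. -/
def cylProj (R : Set (X × Cantor)) (a : List Bool) : Set X := Prod.fst '' (R ∩ Prod.snd ⁻¹' cyl a)

open Classical in
/-- The initial segments of the lexicographically least value of the relation `R`. -/
def lexPrefix (R : Set (X × Cantor)) (x : X) : ℕ → List Bool
  | 0 => []
  | n + 1 => lexPrefix R x n ++ [decide (x ∉ cylProj R (lexPrefix R x n ++ [false]))]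

open Classical in
/-- The lexicographically least value of the relation `R`. -/
def lexSelect (R : Set (X × Cantor)) (x : X) : Cantor :=
  fun n => decide (x ∉ cylProj R (lexPrefix R x n ++ [false]))

theorem lexPrefix_succ (R : Set (X × Cantor)) (x : X) (n : ℕ) :
    lexPrefix R x (n + 1) = lexPrefix R x n ++ [lexSelect R x n] := rfl

theorem length_lexPrefix (R : Set (X × Cantor)) (x : X) (n : ℕ) :
    (lexPrefix R x n).length = n := by
  induction n with
  | zero => rfl
  | succ n ih => simp [lexPrefix_succ, ih]

theorem mem_cyl_lexPrefix {R : Set (X × Cantor)} {x : X} {n : ℕ} {y : Cantor} :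
    y ∈ cyl (lexPrefix R x n) ↔ ∀ i < n, y i = lexSelect R x i := by
  induction n with
  | zero => simp [lexPrefix, cyl]
  | succ n ih =>
    rw [lexPrefix_succ, mem_cyl_append_singleton, ih, length_lexPrefix, Nat.forall_lt_succ_right]

theorem mem_cylProj_lexPrefix {R : Set (X × Cantor)} {x : X} (hx : x ∈ Prod.fst '' R) (n : ℕ) :
    x ∈ cylProj R (lexPrefix R x n) := by
  induction n with
  | zero =>
    obtain ⟨p, hp, rfl⟩ := hx
    exact ⟨p, ⟨hp, by simp [lexPrefix, cyl]⟩, rfl⟩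
  | succ n ih =>
    by_cases h : x ∈ cylProj R (lexPrefix R x n ++ [false])
    · simp [lexPrefix, h]
    · obtain ⟨p, ⟨hpR, hp⟩, rfl⟩ := ih
      refine ⟨p, ⟨hpR, ?_⟩, rfl⟩
      have hlen := length_lexPrefix R p.1 n
      rw [mem_preimage, lexPrefix_succ, mem_cyl_append_singleton]
      refine ⟨hp, ?_⟩
      have hsel : lexSelect R p.1 n = true := by simpa [lexSelect] using h
      rw [hsel, ← Bool.not_eq_false]
      exact fun hf => h ⟨p, ⟨hpR, mem_cyl_append_singleton.2 ⟨hp, hf⟩⟩, rfl⟩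

variable [TopologicalSpace X] {R : Set (X × Cantor)}

theorem lexSelect_mem (hR : IsClosed R) {x : X} (hx : x ∈ Prod.fst '' R) :
    (x, lexSelect R x) ∈ R := by
  have h (n : ℕ) : ∃ y, (x, y) ∈ R ∧ ∀ i < n, y i = lexSelect R x i := by
    obtain ⟨⟨x', y⟩, ⟨hpR, hp⟩, rfl⟩ := mem_cylProj_lexPrefix hx n
    exact ⟨y, hpR, mem_cyl_lexPrefix.1 hp⟩
  choose y hyR hy using h
  have hlim : Tendsto y atTop (𝓝 (lexSelect R x)) := by
    refine tendsto_pi_nhds.2 fun i => tendsto_const_nhds.congr' ?_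
    filter_upwards [eventually_gt_atTop i] with n hn using (hy n i hn).symm
  exact hR.mem_of_tendsto (tendsto_const_nhds.prodMk_nhds hlim) (Eventually.of_forall hyR)

variable [MeasurableSpace X] [OpensMeasurableSpace X]

theorem measurableSet_cylProj (hR : IsClosed R) (a : List Bool) :
    MeasurableSet (cylProj R a) :=
  (isClosedMap_fst_of_compactSpace _
    (hR.inter ((isClopen_cyl a).isClosed.preimage continuous_snd))).measurableSet

theorem measurableSet_lexSelect_apply {n : ℕ} (hR : IsClosed R)
    (h : ∀ a, MeasurableSet {x | lexPrefix R x n = a}) :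
    MeasurableSet {x | lexSelect R x n = true} := by
  have : {x | lexSelect R x n = true} =
      ⋃ a, {x | lexPrefix R x n = a} ∩ (cylProj R (a ++ [false]))ᶜ := by
    ext x
    simp [lexSelect]
  rw [this]
  exact .iUnion fun a => (h a).inter (measurableSet_cylProj hR _).compl

theorem measurableSet_lexPrefix_eq (hR : IsClosed R) (n : ℕ) (a : List Bool) :
    MeasurableSet {x | lexPrefix R x n = a} := by
  induction n generalizing a with
  | zero => exact MeasurableSet.const (([] : List Bool) = a)
  | succ n ih =>
    have hs := measurableSet_lexSelect_apply hR ih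
    have : {x | lexPrefix R x (n + 1) = a} = ⋃ (c : List Bool) (b : Bool) (_ : c ++ [b] = a),
        {x | lexPrefix R x n = c} ∩ {x | lexSelect R x n = b} := by
      ext x
      simp only [lexPrefix_succ, mem_ofPred_eq, mem_iUnion, mem_inter_iff, exists_prop]
      constructor
      · exact fun h => ⟨_, _, h, rfl, rfl⟩
      · rintro ⟨c, b, h, rfl, rfl⟩
        exact h
    rw [this]
    refine .iUnion fun c => .iUnion fun b => .iUnion fun _ => (ih c).inter ?_
    cases b
    · convert hs.compl using 1
      ext x
      simp
    · exact hs

/-- A closed relation with values in the Cantor space has a measurable selector. -/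
theorem measurable_lexSelect (hR : IsClosed R) : Measurable (lexSelect R) :=
  measurable_pi_lambda _ fun n => measurable_to_bool
    (measurableSet_lexSelect_apply hR (measurableSet_lexPrefix_eq hR n))

end Selection

/-- The family of sets of finite sequences coded by a point of the Cantor space. -/
def decodeFam (y : Cantor) (i : ℕ) : Set (List Bool) :=
  {q | y (Nat.pair i (Encodable.encode q)) = true}

open Classical in
theorem exists_decodeFam (F : ℕ → Set (List Bool)) : ∃ y, decodeFam y = F := by
  refine ⟨fun n => decide (∃ i, ∃ q ∈ F i, Nat.pair i (Encodable.encode q) = n), ?_⟩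
  funext i
  ext q
  simp only [decodeFam, mem_ofPred_eq, decide_eq_true_eq, Nat.pair_eq_pair]
  constructor
  · rintro ⟨j, q', hq', rfl, h⟩
    rwa [← Encodable.encode_injective h]
  · exact fun h => ⟨i, q, h, rfl, rfl⟩

open Classical in
/-- The code of `⟨z, F⟩`, where `S` codes the domain of `F` and `y` codes `F`. -/
def survivors (S y z : Cantor) : Cantor := fun i => S i && decide (z ∉ cylSet (decodeFam y i))

theorem survivors_eq_true {S y z : Cantor} {i : ℕ} :
    survivors S y z i = true ↔ S i = true ∧ z ∉ cylSet (decodeFam y i) := by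
  simp [survivors]

theorem survivors_mono {S S' : Cantor} (h : S ≤ S') (y z : Cantor) :
    survivors S y z ≤ survivors S' y z := by
  intro i hi
  rw [survivors_eq_true] at hi ⊢
  exact ⟨h i hi.1, hi.2⟩

theorem measurable_survivors :
    Measurable fun p : Cantor × Cantor × Cantor => survivors p.1 p.2.1 p.2.2 := by
  refine measurable_pi_lambda _ fun i => measurable_to_bool ?_
  have : (fun p : Cantor × Cantor × Cantor => survivors p.1 p.2.1 p.2.2 i) ⁻¹' {true} =
      {p | p.1 i = true} ∩
        (⋃ q : List Bool, {p | p.2.1 (Nat.pair i (Encodable.encode q)) = true} ∩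
          {p | p.2.2 ∈ cyl q})ᶜ := by
    ext p
    simp [survivors_eq_true, cylSet, decodeFam]
  rw [this]
  have hcoord {f : Cantor × Cantor × Cantor → Cantor} (hf : Measurable f) (n : ℕ) :
      MeasurableSet {p | f p n = true} :=
    ((measurable_pi_apply n).comp hf) (measurableSet_singleton true)
  refine (hcoord measurable_fst i).inter (MeasurableSet.iUnion fun q => ?_).compl
  exact (hcoord measurable_snd.fst _).inter (measurable_snd.snd (isOpen_cyl q).measurableSet)

/-- The pairs `(S, y)` such that the test function coded by `y` has weights at most `γ / 2` and
witnesses that removing `z` from the family coded by `S` leads into `B` for many `z`. -/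
def testRel (r θ γ : ℝ) (B : Set Cantor) : Set (Cantor × Cantor) :=
  {p | (∀ i, memCinf r (γ / 2) (decodeFam p.2 i)) ∧
    ENNReal.ofReal γ ≤ sqcap r θ {z | survivors p.1 p.2 z ∈ B}}

theorem isClosed_setOf_memCinf (r ε : ℝ) (i : ℕ) :
    IsClosed {y : Cantor | memCinf r ε (decodeFam y i)} := by
  have h : {y : Cantor | memCinf r ε (decodeFam y i)} = ⋂ t : Finset (List Bool),
      {y | ∑ q ∈ t, (decodeFam y i).indicator (wt r) q ≤ ENNReal.ofReal ε} := by
    ext y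
    simp only [memCinf, wtSum, mem_ofPred_eq, mem_iInter]
    rw [tsum_subtype (decodeFam y i) (wt r), ENNReal.tsum_eq_iSup_sum, iSup_le_iff]
  rw [h]
  refine isClosed_iInter fun t => isClosed_le ?_ continuous_const
  refine continuous_finsetSum _ fun q _ => ?_
  have hq : (fun y : Cantor => (decodeFam y i).indicator (wt r) q) =
      (fun b : Bool => if b = true then wt r q else 0) ∘
        fun y => y (Nat.pair i (Encodable.encode q)) := by
    funext y
    by_cases hy : y (Nat.pair i (Encodable.encode q)) = true <;> simp [Set.indicator, decodeFam, hy]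
  rw [hq]
  exact continuous_of_discreteTopology.comp (continuous_apply _)

/-- If `B` is closed and downward closed, then `testRel` is closed: the part of a test function
that escapes to high levels only affects `z` in a set of small measure. -/
theorem isClosed_testRel {r : ℝ} (hr : r < 1) (θ γ : ℝ) {B : Set Cantor} (hB : IsClosed B)
    (hBl : IsLowerSet B) : IsClosed (testRel r θ γ B) := by
  have hwt : IsClosed {p : Cantor × Cantor | ∀ i, memCinf r (γ / 2) (decodeFam p.2 i)} := by
    simp only [ofPred_forall]
    exact isClosed_iInter fun i => (isClosed_setOf_memCinf r _ i).preimage continuous_snd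
  rw [isClosed_iff_ultrafilter]
  rintro ⟨S, y⟩ u hu hR
  refine ⟨isClosed_iff_ultrafilter.1 hwt _ u hu (mem_of_superset hR fun p hp => hp.1), ?_⟩
  refine le_iInf₂ fun Z hZ => le_iInf fun hZδ => le_iInf₂ fun A hA => ?_
  by_contra! hAγ
  obtain ⟨Z', hZZ', hZ'o, hZ'δ⟩ := Set.exists_isOpen_lt_of_lt Z _ hZδ
  obtain ⟨ε, hε, hεlt⟩ := ENNReal.lt_iff_exists_add_pos_lt.1 hZ'δ
  obtain ⟨ε', hε'pos, hε'sum⟩ :=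
    ENNReal.exists_pos_sum_of_countable' (ENNReal.coe_pos.2 hε).ne' ℕ
  choose m hm using fun i => exists_level_cantorMeasure_le hr (γ / 2) (hε'pos i)
  have hz (p : Cantor × Cantor) : ∃ z, p ∈ testRel r θ γ B → survivors p.1 p.2 z ∈ B ∧
      z ∉ Z' ∧ z ∉ cylSet A ∧ ∀ i, z ∉ cylSet {a ∈ decodeFam p.2 i | m i ≤ a.length} := by
    by_contra! hcon
    have hp : p ∈ testRel r θ γ B := (hcon fun _ => false).1
    refine hAγ.not_ge (hp.2.trans (sqcap_le_of_subset
      (Z := Z' ∪ ⋃ i, cylSet {a ∈ decodeFam p.2 i | m i ≤ a.length}) ?_ ?_ ?_))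
    · exact hZ'o.measurableSet.union (.iUnion fun i => (isOpen_cylSet _).measurableSet)
    · refine (measure_union_le _ _).trans_lt (lt_of_le_of_lt ?_ hεlt)
      refine add_le_add_right ((measure_iUnion_le _).trans ?_) _
      exact (ENNReal.tsum_le_tsum fun i => hm i _ (hp.1 i)).trans hε'sum.le
    · rintro z ⟨hzB, hz⟩
      by_contra hzA
      obtain ⟨i, hi⟩ := (hcon z).2 hzB (fun h => hz (Or.inl h)) hzA
      exact hz (Or.inr (mem_iUnion.2 ⟨i, hi⟩))
  choose z hz using hz
  have hlim {f : Cantor × Cantor → Cantor} :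
      ∃ x, Tendsto f u (𝓝 x) := by
    obtain ⟨x, -, hx⟩ := isCompact_univ.ultrafilter_le_nhds (u.map f) (by simp)
    exact ⟨x, hx⟩
  obtain ⟨z₀, hz₀⟩ := hlim (f := z)
  obtain ⟨T, hT⟩ := hlim (f := fun p => survivors p.1 p.2 (z p))
  have hev : ∀ᶠ p in (u : Filter (Cantor × Cantor)), p ∈ testRel r θ γ B := hR
  have hTB : T ∈ B := hB.mem_of_tendsto hT (hev.mono fun p hp => (hz p hp).1)
  have hz₀Z : z₀ ∉ Z' := hZ'o.isClosed_compl.mem_of_tendsto hz₀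
    (hev.mono fun p hp => (hz p hp).2.1)
  have hz₀A : z₀ ∉ cylSet A := (isOpen_cylSet A).isClosed_compl.mem_of_tendsto hz₀
    (hev.mono fun p hp => (hz p hp).2.2.1)
  have hu₁ : Tendsto Prod.fst (u : Filter (Cantor × Cantor)) (𝓝 S) :=
    (continuous_fst.tendsto (S, y)).mono_left hu
  have hu₂ : Tendsto Prod.snd (u : Filter (Cantor × Cantor)) (𝓝 y) :=
    (continuous_snd.tendsto (S, y)).mono_left hu
  have hcoord {f : Cantor × Cantor → Cantor} {x : Cantor}
      (hf : Tendsto f (u : Filter (Cantor × Cantor)) (𝓝 x)) (n : ℕ) :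
      ∀ᶠ p in (u : Filter (Cantor × Cantor)), f p n = x n :=
    (tendsto_pi_nhds.1 hf n).eventually (p := fun b => b = x n) (by simp [nhds_discrete])
  refine hz₀A (hA ⟨hBl (a := T) ?_ hTB, fun h => hz₀Z (hZZ' h)⟩)
  intro i hi
  rw [survivors_eq_true] at hi
  have hfin : ∀ᶠ p in (u : Filter (Cantor × Cantor)), ∀ q ∈ {q : List Bool | q.length < m i},
      q ∈ decodeFam p.2 i → z p ∉ cyl q := by
    refine ((List.finite_length_lt Bool (m i)).eventually_all).2 fun q _ => ?_
    by_cases hq : z₀ ∈ cyl q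
    · filter_upwards [hcoord hu₂ (Nat.pair i (Encodable.encode q))] with p hp hqp
      refine absurd (mem_biUnion ?_ hq) hi.2
      exact hp.symm.trans hqp
    · filter_upwards [hz₀.eventually ((isClopen_cyl q).compl.isOpen.mem_nhds hq)] with p hp _
      exact hp
  have hfinal : ∀ᶠ p in (u : Filter (Cantor × Cantor)), T i = true := by
    filter_upwards [hcoord hT i, hcoord hu₁ i, hev, hfin] with p hTp hSp hp hq
    rw [← hTp, survivors_eq_true]
    refine ⟨hSp.trans hi.1, fun hmem => ?_⟩
    obtain ⟨q, hqF, hqz⟩ := mem_iUnion₂.1 hmem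
    rcases lt_or_ge q.length (m i) with hlt | hge
    · exact hq q hlt hqF hqz
    · exact (hz p hp).2.2.2 i (mem_biUnion (show q ∈ {a ∈ _ | _} from ⟨hqF, hge⟩) hqz)
  exact hfinal.exists.choose_spec

theorem testRel_mono_left {r θ γ : ℝ} {B : Set Cantor} (hBl : IsLowerSet B) {S S' y : Cantor}
    (h : S ≤ S') (hS : (S', y) ∈ testRel r θ γ B) : (S, y) ∈ testRel r θ γ B :=
  ⟨hS.1, hS.2.trans (sqcap_mono r θ fun z hz => hBl (survivors_mono h y z) hz)⟩

/-- Witnesses that the family `{e i | S i}` is not in `𝒩^∞_{k+1}`: a point outside the union for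
`k = 0`, and a code of a test function otherwise. -/
def failRel (r : ℝ) (Θ Γ : ℕ → ℝ) (e : ℕ → Set (List Bool)) : ℕ → Set (Cantor × Cantor)
  | 0 => {p | ∀ i, p.1 i = true → p.2 ∉ cylSet (e i)}
  | k + 1 => testRel r (Θ k) (Γ (k + 1)) (Prod.fst '' failRel r Θ Γ e k)

section FailRel

variable {r : ℝ} {Θ Γ : ℕ → ℝ} {e : ℕ → Set (List Bool)}

theorem isLowerSet_failRel (k : ℕ) : IsLowerSet (Prod.fst '' failRel r Θ Γ e k) := by
  induction k with
  | zero =>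
    rintro S' S h ⟨⟨S', z⟩, hz, rfl⟩
    exact ⟨(S, z), fun i hi => hz i (h i hi), rfl⟩
  | succ k ih =>
    rintro S' S h ⟨⟨S', y⟩, hy, rfl⟩
    exact ⟨(S, y), testRel_mono_left ih h hy, rfl⟩

theorem isClosed_failRel (hr : r < 1) (k : ℕ) : IsClosed (failRel r Θ Γ e k) := by
  induction k with
  | zero =>
    simp only [failRel, ofPred_forall]
    refine isClosed_iInter fun i => ?_
    have h₁ : IsOpen {p : Cantor × Cantor | p.1 i = true} :=
      isOpen_discrete {true} |>.preimage
        ((continuous_apply (A := fun _ : ℕ => Bool) i).comp continuous_fst)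
    exact isClosed_imp h₁ ((isOpen_cylSet _).isClosed_compl.preimage continuous_snd)
  | succ k ih =>
    exact isClosed_testRel hr _ _ (isClosedMap_fst_of_compactSpace _ ih) (isLowerSet_failRel k)

theorem isClosed_image_failRel (hr : r < 1) (k : ℕ) :
    IsClosed (Prod.fst '' failRel r Θ Γ e k) :=
  isClosedMap_fst_of_compactSpace _ (isClosed_failRel hr k)

theorem mem_failRel_of_notMem_NrecInf (k : ℕ) (S : Cantor)
    (h : e '' {i | S i = true} ∉ NrecInf r Θ Γ (k + 1)) : S ∈ Prod.fst '' failRel r Θ Γ e k := by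
  classical
  induction k generalizing S with
  | zero =>
    simp only [NrecInf, mem_ofPred_eq, eq_univ_iff_forall, not_forall] at h
    obtain ⟨z, hz⟩ := h
    refine ⟨(S, z), fun i hi hzi => hz ?_, rfl⟩
    obtain ⟨a, ha, hza⟩ := mem_iUnion₂.1 hzi
    exact mem_biUnion (mem_sUnion.2 ⟨e i, ⟨i, hi, rfl⟩, ha⟩) hza
  | succ k ih =>
    simp only [NrecInf, mem_ofPred_eq, not_forall, not_lt] at h
    obtain ⟨F, hF, hsq⟩ := h
    obtain ⟨y, hy⟩ := exists_decodeFam fun i => if S i = true then F (e i) else ∅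
    refine ⟨(S, y), ⟨fun i => ?_, hsq.trans (sqcap_mono _ _ fun z hz => ih _ ?_)⟩, rfl⟩
    · simp only [hy]
      split_ifs with hi
      · exact hF _ ⟨i, hi, rfl⟩
      · simp [memCinf, wtSum]
    · have : e '' {i | survivors S y z i = true} = angbr z F (e '' {i | S i = true}) := by
        ext w
        simp only [angbr, mem_image, mem_ofPred_eq, survivors_eq_true, hy]
        constructor
        · rintro ⟨i, ⟨hi, hzi⟩, rfl⟩
          exact ⟨⟨i, hi, rfl⟩, by simpa [hi] using hzi⟩
        · rintro ⟨⟨i, hi, rfl⟩, hzi⟩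
          exact ⟨i, ⟨hi, by simpa [hi] using hzi⟩, rfl⟩
      rw [this]
      exact hz

end FailRel

theorem SqTG_mono {r : ℝ} {Θ Γ : ℕ → ℝ} {k : ℕ} {X Y : Set (Fin (k + 1) → Cantor)} (h : X ⊆ Y)
    (hX : SqTG r Θ Γ k X) : SqTG r Θ Γ k Y := by
  induction k with
  | zero => exact hX.trans (sqcap_mono _ _ fun _ hy => h hy)
  | succ k ih => exact hX.trans (sqcap_mono _ _ fun _ hx => ih (fun _ hy => h hy) hx)

theorem not_SqTG_empty {r : ℝ} {Θ Γ : ℕ → ℝ} (hΘ : ∀ i, 0 < Θ i) (hΓ : ∀ i, 0 < Γ i) (k : ℕ) :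
    ¬ SqTG r Θ Γ k ∅ := by
  induction k with
  | zero => simp [SqTG, sqcap_empty (hΘ 0), hΓ 0]
  | succ k ih => simp [SqTG, ih, sqcap_empty (hΘ (k + 1)), hΓ (k + 1)]

/-- The parameters `Θ` shifted by one, starting with the largest value for which `□(2^ℕ)` holds. -/
def shiftedParam (Θ Γ : ℕ → ℝ) : ℕ → ℝ
  | 0 => 1 - Γ 0
  | k + 1 => Θ k

/-- For families that fail `𝒩^∞_{k+1}`, there are, uniformly measurably, a large subset of
`(2^ℕ)^(k+1)` and a function on it for which no preimage of a member of the family is large. -/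
theorem exists_measurable_counterexample {r : ℝ} (hr : r < 1) {Θ Γ : ℕ → ℝ}
    (hΓ : ∀ i, 0 < Γ i) (e : ℕ → Set (List Bool)) (k : ℕ) :
    ∃ (D : Set (Cantor × (Fin (k + 1) → Cantor))) (u : Cantor × (Fin (k + 1) → Cantor) → Cantor),
      MeasurableSet D ∧ Measurable u ∧ ∀ S ∈ Prod.fst '' failRel r Θ Γ e k,
        SqTG r (shiftedParam Θ Γ) Γ k {v | (S, v) ∈ D} ∧
        ∀ i, S i = true → ∀ η : ℕ → ℝ, (∀ j, 0 < η j) →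
          ¬ SqTG r η Γ k {v | (S, v) ∈ D ∧ u (S, v) ∈ cylSet (e i)} := by
  have hcl := fun k => isClosed_failRel (Θ := Θ) (Γ := Γ) (e := e) hr k
  induction k with
  | zero =>
    refine ⟨univ, fun p => lexSelect (failRel r Θ Γ e 0) p.1, .univ,
      (measurable_lexSelect (hcl 0)).comp measurable_fst, fun S hS => ⟨?_, ?_⟩⟩
    · exact le_sqcap_univ hr.le
    · intro i hi η hη hX
      refine not_SqTG_empty hη hΓ 0 (SqTG_mono (fun v hv => ?_) hX)
      exact lexSelect_mem (hcl 0) hS i hi hv.2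
  | succ k ih =>
    obtain ⟨D, u, hD, hu, hDu⟩ := ih
    set s := lexSelect (failRel r Θ Γ e (k + 1))
    set φ : Cantor × (Fin (k + 2) → Cantor) → Cantor × (Fin (k + 1) → Cantor) :=
      fun p => (survivors p.1 (s p.1) (p.2 0), Fin.tail p.2)
    have hφm : Measurable φ := by
      refine Measurable.prodMk ?_ ?_
      · exact measurable_survivors.comp (measurable_fst.prodMk
          (((measurable_lexSelect (hcl (k + 1))).comp measurable_fst).prodMk
            ((measurable_pi_apply 0).comp measurable_snd)))
      · exact measurable_pi_lambda _ fun j => (measurable_pi_apply j.succ).comp measurable_snd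
    refine ⟨φ ⁻¹' (D ∩ Prod.fst ⁻¹' (Prod.fst '' failRel r Θ Γ e k)), u ∘ φ, hφm (hD.inter ?_),
      hu.comp hφm, fun S hS => ?_⟩
    · exact measurable_fst (isClosed_image_failRel hr k).measurableSet
    have hsS := lexSelect_mem (hcl (k + 1)) hS
    refine ⟨?_, fun i hi η hη hX => ?_⟩
    · refine hsS.2.trans (sqcap_mono _ _ fun z hz => ?_)
      refine SqTG_mono (fun v hv => ?_) (hDu _ hz).1
      exact ⟨hv, hz⟩
    · have hsub : {z | SqTG r η Γ k {v : Fin (k + 1) → Cantor | Fin.cons z v ∈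
          {v | (S, v) ∈ φ ⁻¹' (D ∩ Prod.fst ⁻¹' (Prod.fst '' failRel r Θ Γ e k)) ∧
            (u ∘ φ) (S, v) ∈ cylSet (e i)}}} ⊆ cylSet (decodeFam (s S) i) := by
        intro z hz
        by_contra hzi
        by_cases hbad : survivors S (s S) z ∈ Prod.fst '' failRel r Θ Γ e k
        · refine (hDu _ hbad).2 i (survivors_eq_true.2 ⟨hi, hzi⟩) η hη (SqTG_mono ?_ hz)
          exact fun v hv => ⟨hv.1.1, hv.2⟩
        · exact not_SqTG_empty hη hΓ k (SqTG_mono (fun v hv => hbad hv.1.2) hz)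
      have hle := hX.trans ((sqcap_mono _ _ hsub).trans ((sqcap_cylSet_le (hη _) _).trans
        (hsS.1 i)))
      rw [ENNReal.ofReal_le_ofReal_iff (by linarith [hΓ (k + 1)])] at hle
      linarith [hΓ (k + 1)]

/-- A measurable set contains, up to small measure, a compact set on which a given measurable
function to the Cantor space is continuous. -/
theorem exists_isCompact_continuousOn {X : Type*} [TopologicalSpace X] [CompactSpace X]
    [TopologicalSpace.PseudoMetrizableSpace X] [MeasurableSpace X] [BorelSpace X]
    (μ : Measure X) [IsFiniteMeasure μ] {D : Set X} (hD : MeasurableSet D) {u : X → Cantor}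
    (hu : Measurable u) {ε : ℝ≥0∞} (hε : ε ≠ 0) :
    ∃ C ⊆ D, IsCompact C ∧ ContinuousOn u C ∧ μ (D \ C) < ε := by
  obtain ⟨δ, hδ, hδε⟩ := ENNReal.exists_pos_sum_of_countable' hε (Option (ℕ × Bool))
  set A : Option (ℕ × Bool) → Set X := fun o => o.elim D fun p => {x | u x p.1 = p.2} with hA
  have hAm (o : Option (ℕ × Bool)) : MeasurableSet (A o) := by
    rcases o with - | ⟨n, b⟩
    · exact hD
    · exact ((measurable_pi_apply n).comp hu) (measurableSet_singleton b)
  choose K hKA hKc hKδ using fun o =>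
    (hAm o).exists_isClosed_sdiff_lt (measure_ne_top μ (A o)) (hδ o).ne'
  set C : Set X := K none ∩ ⋂ n : ℕ, (K (some (n, false)) ∪ K (some (n, true))) with hC
  have hCc : IsClosed C :=
    (hKc none).inter (isClosed_iInter fun n => (hKc (some (n, false))).union (hKc (some (n, true))))
  refine ⟨C, inter_subset_left.trans (hKA none), hCc.isCompact, ?_, ?_⟩
  · rw [continuousOn_pi]
    intro n
    rw [continuousOn_iff_isClosed]
    intro t ht
    refine ⟨⋃ b ∈ t, K (some (n, b)), t.toFinite.isClosed_biUnion fun b _ => hKc _, ?_⟩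
    ext x
    simp only [mem_inter_iff, mem_preimage, mem_iUnion, exists_prop, and_congr_left_iff]
    intro hx
    constructor
    · intro hxt
      rcases mem_iInter.1 hx.2 n with h | h
      · exact ⟨false, by rwa [← show u x n = false from hKA _ h], h⟩
      · exact ⟨true, by rwa [← show u x n = true from hKA _ h], h⟩
    · rintro ⟨b, hb, h⟩
      rwa [show u x n = b from hKA _ h]
  · refine lt_of_le_of_lt (measure_mono (t := ⋃ o, A o \ K o) ?_)
      ((measure_iUnion_le _).trans_lt ((ENNReal.tsum_le_tsum fun o => (hKδ o).le).trans_lt hδε))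
    rintro x ⟨hxD, hxC⟩
    simp only [hC, mem_inter_iff, mem_iInter, mem_union, not_and_or, not_forall, not_or] at hxC
    rcases hxC with h | ⟨n, h⟩
    · exact mem_iUnion.2 ⟨none, hxD, h⟩
    · refine mem_iUnion.2 ⟨some (n, u x n), rfl, ?_⟩
      cases u x n
      · exact h.1
      · exact h.2

theorem measurePreserving_cons (k : ℕ) :
    MeasurePreserving
      (fun p : Cantor × (Fin k → Cantor) => (Fin.cons p.1 p.2 : Fin (k + 1) → Cantor))
      (cantorMeasure.prod (Measure.pi fun _ => cantorMeasure))
      (Measure.pi fun _ => cantorMeasure) := by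
  have h := (measurePreserving_piFinSuccAbove (fun _ : Fin (k + 1) => cantorMeasure) 0).symm
  convert h using 1
  funext p
  simp [MeasurableEquiv.piFinSuccAbove_symm_apply, Fin.consEquiv]

theorem pi_cantorMeasure_succ {k : ℕ} {E : Set (Fin (k + 1) → Cantor)} (hE : MeasurableSet E) :
    Measure.pi (fun _ : Fin (k + 1) => cantorMeasure) E =
      ∫⁻ z, Measure.pi (fun _ : Fin k => cantorMeasure) {v | Fin.cons z v ∈ E}
        ∂cantorMeasure := by
  have h := measurePreserving_cons k
  rw [← h.measure_preimage hE.nullMeasurableSet, Measure.prod_apply (h.measurable hE)]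
  rfl

/-- Removing a set of sufficiently small product measure preserves `□`, at the cost of an
arbitrarily small decrease of the parameters. -/
theorem exists_measure_SqTG_of_diff_subset (r : ℝ) {Θ Θ' : ℕ → ℝ} (Γ : ℕ → ℝ)
    (hΘ : ∀ i, 0 < Θ i) (hΘΘ' : ∀ i, Θ i < Θ' i) (k : ℕ) :
    ∃ ε : ℝ≥0∞, ε ≠ 0 ∧ ∀ D C E : Set (Fin (k + 1) → Cantor), MeasurableSet E →
      Measure.pi (fun _ : Fin (k + 1) => cantorMeasure) E ≤ ε → D \ E ⊆ C →
      SqTG r Θ' Γ k D → SqTG r Θ Γ k C := by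
  induction k with
  | zero =>
    refine ⟨ENNReal.ofReal (Θ' 0 - Θ 0), by simpa using hΘΘ' 0, fun D C E hE hEε hDC hD => ?_⟩
    have hcons : Measurable fun z : Cantor => (fun _ : Fin 1 => z) :=
      measurable_pi_lambda _ fun _ => measurable_id
    have hmeas : cantorMeasure {z | (fun _ : Fin 1 => z) ∈ E} ≤
        ENNReal.ofReal (Θ' 0 - Θ 0) := by
      refine le_of_eq_of_le ?_ hEε
      exact (measurePreserving_funUnique cantorMeasure (Fin 1)).symm.measure_preimage
        hE.nullMeasurableSet
    have := sqcap_add_le_sqcap (r := r) (hΘ 0).le (hcons hE) hmeas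
      (X := {z | (fun _ : Fin 1 => z) ∈ D}) (Y := {z | (fun _ : Fin 1 => z) ∈ C})
      (fun z hz => hDC hz) (by linarith [hΘΘ' 0])
    rw [add_sub_cancel] at this
    exact hD.trans this
  | succ k ih =>
    obtain ⟨ε, hε, h⟩ := ih
    set δ := ENNReal.ofReal (Θ' (k + 1) - Θ (k + 1)) with hδ
    have hδ0 : δ ≠ 0 := by simpa [hδ] using hΘΘ' (k + 1)
    wlog hεtop : ε ≠ ⊤ generalizing ε
    · exact this 1 one_ne_zero (fun D C E hE hEε => h D C E hE (hEε.trans (by simp_all)))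
        ENNReal.one_ne_top
    refine ⟨ε * δ, mul_ne_zero hε hδ0, fun D C E hE hEε hDC hD => ?_⟩
    set G : Set Cantor := {z | ε ≤ Measure.pi (fun _ : Fin (k + 1) => cantorMeasure)
      {v | Fin.cons z v ∈ E}} with hG
    have hmp := measurePreserving_cons (k + 1)
    have hfm : Measurable fun z : Cantor => Measure.pi (fun _ : Fin (k + 1) => cantorMeasure)
        {v | (Fin.cons z v : Fin (k + 2) → Cantor) ∈ E} :=
      measurable_measure_prodMk_left (hmp.measurable hE)
    have hGm : MeasurableSet G := measurableSet_le measurable_const hfm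
    have hGδ : cantorMeasure G ≤ δ := by
      have := mul_meas_ge_le_lintegral (μ := cantorMeasure) hfm ε
      rw [← pi_cantorMeasure_succ hE] at this
      exact (ENNReal.mul_le_mul_iff_right hε hεtop).1 (this.trans hEε)
    have := sqcap_add_le_sqcap (r := r) (hΘ (k + 1)).le hGm hGδ
      (X := {z | SqTG r Θ' Γ k {v | Fin.cons z v ∈ D}})
      (Y := {z | SqTG r Θ Γ k {v | Fin.cons z v ∈ C}})
      (fun z hz => ?_) (by linarith [hΘΘ' (k + 1)])
    · rw [add_sub_cancel] at this
      exact hD.trans this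
    · refine h _ _ {v | Fin.cons z v ∈ E} ?_ (not_le.1 hz.2).le (fun v hv => hDC hv) hz.1
      exact hmp.measurable.comp measurable_prodMk_left hE

theorem lt_shiftedParam {Θ Γ : ℕ → ℝ} (hΘ : StrictAnti Θ) (h : Θ 0 + Γ 0 < 1) (k : ℕ) :
    Θ k < shiftedParam Θ Γ k := by
  cases k with
  | zero => exact lt_sub_iff_add_lt.2 h
  | succ k => exact hΘ k.lt_succ_self

theorem mem_NrecInf_of_mem_rhoStar {r : ℝ} (hr : r < 1) {Θ Γ : ℕ → ℝ} (hΘpos : ∀ i, 0 < Θ i)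
    (hΓpos : ∀ i, 0 < Γ i) (hΘanti : StrictAnti Θ) (hΘΓ : Θ 0 + Γ 0 < 1)
    {𝒳 : Set (Set (List Bool))} (h𝒳 : ∀ a ∈ 𝒳, a.Finite) {d : ℕ} (hd : d ∈ rhoStar r Θ Γ 𝒳) :
    𝒳 ∈ NrecInf r Θ Γ d := by
  classical
  obtain ⟨hd1, hd⟩ := hd
  obtain ⟨k, rfl⟩ : ∃ k, d = k + 1 := ⟨d - 1, by omega⟩
  by_contra hN
  obtain ⟨e, he⟩ := (countable_ofPred_finite_subset
    (countable_univ (α := List Bool))).exists_eq_range ⟨∅, by simp⟩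
  have hS : e '' {i | decide (e i ∈ 𝒳) = true} = 𝒳 := by
    ext a
    simp only [decide_eq_true_eq, mem_image, mem_ofPred_eq]
    constructor
    · rintro ⟨i, hi, rfl⟩
      exact hi
    · intro ha
      obtain ⟨i, rfl⟩ : a ∈ range e := he ▸ ⟨h𝒳 a ha, subset_univ a⟩
      exact ⟨i, ha, rfl⟩
  obtain ⟨D, u, hD, hu, hDu⟩ := exists_measurable_counterexample (Θ := Θ) hr hΓpos e k
  set S : Cantor := fun i => decide (e i ∈ 𝒳)
  obtain ⟨hbig, hsmall⟩ := hDu S (mem_failRel_of_notMem_NrecInf k S (hS ▸ hN))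
  obtain ⟨ε, hε, hmeas⟩ := exists_measure_SqTG_of_diff_subset r Γ hΘpos
    (lt_shiftedParam hΘanti hΘΓ) k
  have hsec : Measurable fun v : Fin (k + 1) → Cantor => (S, v) := measurable_prodMk_left
  obtain ⟨C, hCD, hC, hCu, hCε⟩ := exists_isCompact_continuousOn
    (Measure.pi fun _ : Fin (k + 1) => cantorMeasure) (hsec hD) (hu.comp hsec) hε
  have hCbig : SqTG r Θ Γ k C := hmeas _ C _ ((hsec hD).diff hC.measurableSet) hCε.le
    (fun v hv => by_contra fun hvC => hv.2 ⟨hv.1, hvC⟩) hbig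
  obtain ⟨x, hx, η, hη, hsq⟩ := hd C hC hCbig _ hCu
  obtain ⟨i, hi, rfl⟩ := hS.symm ▸ hx
  exact hsmall i hi η hη (SqTG_mono (fun v hv => ⟨hCD hv.1, hv.2⟩) hsq)

theorem statement13 (r : ℝ) (hr0 : 0 < r) (hr1 : r < 1)
    (Θ Γ : ℕ → ℝ) (hΘpos : ∀ i, 0 < Θ i) (hΓpos : ∀ i, 0 < Γ i)
    (hΘanti : StrictAnti Θ) (hΘlim : Filter.Tendsto Θ Filter.atTop (nhds 0))
    (hΘΓ : ∀ j, Θ j + Γ j < 1) (hΘΓsucc : ∀ j, Θ j + Γ (j + 1) < 1)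
    (hΓdense : ∀ x ∈ Set.Ioo (0 : ℝ) 1, x ∈ closure (Set.range Γ))
    (𝒳 : Set (Set (List Bool))) (h𝒳 : ∀ a ∈ 𝒳, a.Finite) :
    rho r Θ Γ 𝒳 ≤ nuInf r Θ Γ 𝒳 := by
  refine sSup_le ?_
  rintro _ ⟨d, hd, rfl⟩
  exact le_sSup ⟨d, mem_NrecInf_of_mem_rhoStar hr1 hΘpos hΓpos hΘanti (hΘΓ 0) h𝒳 hd, rfl⟩
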